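/- For any k ≥ 2, a complete first-order theory T has SOP₂ if and only if T has k-DCTP₁. -/

import Mathlib

/- Common model-theoretic infrastructure for formalizing
   "NSOP₂ theories are NSOP₁" (arXiv:2206.08512).

   We work with a monster model `𝕄` of a complete theory: a sufficiently
   saturated and strongly homogeneous `L`-structure.  Tuples are functions
   `α → 𝕄`; sets of formulas with parameters are coded via `FmlP`. -/

open FirstOrder Language

universe u v w

namespace NSOP2Paper

/-- A first-order formula in free variables `α ⊕ Fin n` together with an
`n`-tuple of parameters from `𝕄`. -/
abbrev FmlP (L : FirstOrder.Language.{u, u}) (𝕄 : Type u) (α : Type v) :=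
  Σ n : ℕ, L.Formula (α ⊕ Fin n) × (Fin n → 𝕄)

/-- `a ≡_C b` : the tuples `a` and `b` satisfy the same formulas with
parameters from `C`. -/
def EqTpOver (L : FirstOrder.Language.{u, u}) {𝕄 : Type u} [L.Structure 𝕄] (C : Set 𝕄)
    {α : Type v} (a b : α → 𝕄) : Prop :=
  ∀ (n : ℕ) (φ : L.Formula (α ⊕ Fin n)) (c : Fin n → 𝕄), (∀ i, c i ∈ C) →
    (φ.Realize (Sum.elim a c) ↔ φ.Realize (Sum.elim b c))

/-- `tp(a / C)` is finitely satisfiable in `Ms`: every formula over `C`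
satisfied by `a` has a realization by a tuple from `Ms`. -/
def FinSatIn (L : FirstOrder.Language.{u, u}) {𝕄 : Type u} [L.Structure 𝕄] (Ms : Set 𝕄)
    {α : Type v} (a : α → 𝕄) (C : Set 𝕄) : Prop :=
  ∀ (n : ℕ) (φ : L.Formula (α ⊕ Fin n)) (c : Fin n → 𝕄), (∀ i, c i ∈ C) →
    φ.Realize (Sum.elim a c) →
    ∃ m : α → 𝕄, (∀ i, m i ∈ Ms) ∧ φ.Realize (Sum.elim m c)

/-- `Ms` is the underlying set of a (small) elementary submodel of `𝕄`. -/
def IsElemSubmodel (L : FirstOrder.Language.{u, u}) {𝕄 : Type u} [L.Structure 𝕄] (Ms : Set 𝕄) : Prop :=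
  ∃ S : L.ElementarySubstructure 𝕄, (S : Set 𝕄) = Ms

/-- A complete consistent global type (a complete type over the monster `𝕄`)
in variables `α`, coded as the set of formulas-with-parameters it contains. -/
structure GlobalType (L : FirstOrder.Language.{u, u}) (𝕄 : Type u) [L.Structure 𝕄] (α : Type v) where
  carrier : Set (FmlP L 𝕄 α)
  consistent : ∀ t : Finset (FmlP L 𝕄 α), ↑t ⊆ carrier →
    ∃ a : α → 𝕄, ∀ p ∈ t, p.2.1.Realize (Sum.elim a p.2.2)
  complete : ∀ (n : ℕ) (φ : L.Formula (α ⊕ Fin n)) (c : Fin n → 𝕄),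
    (⟨n, (φ, c)⟩ : FmlP L 𝕄 α) ∈ carrier ∨ (⟨n, (φ.not, c)⟩ : FmlP L 𝕄 α) ∈ carrier

variable {L : FirstOrder.Language.{u, u}} {𝕄 : Type u} [L.Structure 𝕄]

/-- The global type `q` is finitely satisfiable in `Ms` (i.e. it is a coheir of
its restriction to `Ms`). -/
def GlobalType.FinSatInM {α : Type v} (q : GlobalType L 𝕄 α) (Ms : Set 𝕄) : Prop :=
  ∀ t : Finset (FmlP L 𝕄 α), ↑t ⊆ q.carrier →
    ∃ m : α → 𝕄, (∀ i, m i ∈ Ms) ∧ ∀ p ∈ t, p.2.1.Realize (Sum.elim m p.2.2)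

/-- `a ⊨ q|_C` : the tuple `a` realizes the restriction of the global type `q`
to parameters from `C`. -/
def RealizesType {α : Type v} (q : GlobalType L 𝕄 α) (a : α → 𝕄) (C : Set 𝕄) : Prop :=
  ∀ (n : ℕ) (φ : L.Formula (α ⊕ Fin n)) (c : Fin n → 𝕄), (∀ i, c i ∈ C) →
    (⟨n, (φ, c)⟩ : FmlP L 𝕄 α) ∈ q.carrier → φ.Realize (Sum.elim a c)

/-- The global type `q` extends `tp(a / C)`. -/
def ExtendsTpOver {α : Type v} (q : GlobalType L 𝕄 α) (C : Set 𝕄) (a : α → 𝕄) : Prop :=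
  ∀ (n : ℕ) (φ : L.Formula (α ⊕ Fin n)) (c : Fin n → 𝕄), (∀ i, c i ∈ C) →
    φ.Realize (Sum.elim a c) → (⟨n, (φ, c)⟩ : FmlP L 𝕄 α) ∈ q.carrier

/-- `B` is a coheir Morley sequence over `Ms` in the global type `q`:
`q` is finitely satisfiable in `Ms` and `B i ⊨ q|_(Ms ∪ B_{<i})`. -/
def MorleyIn {α : Type v} (q : GlobalType L 𝕄 α) (Ms : Set 𝕄) (B : ℕ → α → 𝕄) : Prop :=
  q.FinSatInM Ms ∧
    ∀ i : ℕ, RealizesType q (B i) (Ms ∪ ⋃ (j : ℕ) (_ : j < i), Set.range (B j))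

/-- `B` is a coheir Morley sequence over `Ms`. -/
def CoheirMorley (L : FirstOrder.Language.{u, u}) {𝕄 : Type u} [L.Structure 𝕄] (Ms : Set 𝕄)
    {α : Type v} (B : ℕ → α → 𝕄) : Prop :=
  ∃ q : GlobalType L 𝕄 α, MorleyIn q Ms B

/-- Flatten an `ℕ`-indexed sequence of `α`-tuples into a single tuple. -/
def flatSeq {α : Type v} (I : ℕ → α → 𝕄) : ℕ × α → 𝕄 := fun p => I p.1 p.2

/-- The sequence `I` is indiscernible over `C`. -/
def IndiscernibleOver (L : FirstOrder.Language.{u, u}) {𝕄 : Type u} [L.Structure 𝕄] (C : Set 𝕄)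
    {α : Type v} (I : ℕ → α → 𝕄) : Prop :=
  ∀ (n : ℕ) (f g : Fin n → ℕ), StrictMono f → StrictMono g →
    EqTpOver L C (fun p : Fin n × α => I (f p.1) p.2) (fun p : Fin n × α => I (g p.1) p.2)

/-- `𝕄` is `κ`-saturated: every finitely satisfiable set of formulas in fewer
than `κ` variables over a parameter set of size `< κ` is realized in `𝕄`. -/
def IsSaturated (L : FirstOrder.Language.{u, u}) (𝕄 : Type u) [L.Structure 𝕄] (κ : Cardinal.{u}) : Prop :=
  ∀ (α : Type u) (A : Set 𝕄), Cardinal.mk α < κ → Cardinal.mk A < κ →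
    ∀ Γ : Set (FmlP L 𝕄 α), (∀ p ∈ Γ, ∀ i, p.2.2 i ∈ A) →
      (∀ t : Finset (FmlP L 𝕄 α), ↑t ⊆ Γ →
        ∃ a : α → 𝕄, ∀ p ∈ t, p.2.1.Realize (Sum.elim a p.2.2)) →
      ∃ a : α → 𝕄, ∀ p ∈ Γ, p.2.1.Realize (Sum.elim a p.2.2)

/-- `𝕄` is strongly `κ`-homogeneous: partial elementary maps between tuples of
length `< κ` extend to automorphisms of `𝕄`. -/
def IsStronglyHomogeneous (L : FirstOrder.Language.{u, u}) (𝕄 : Type u) [L.Structure 𝕄]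
    (κ : Cardinal.{u}) : Prop :=
  ∀ (α : Type u), Cardinal.mk α < κ → ∀ a b : α → 𝕄, EqTpOver L (∅ : Set 𝕄) a b →
    ∃ σ : 𝕄 ≃[L] 𝕄, ∀ i, σ (a i) = b i

/-- `𝕄` is a monster model (for smallness degree `κ`): sufficiently saturated
and strongly homogeneous. -/
def IsMonster (L : FirstOrder.Language.{u, u}) (𝕄 : Type u) [L.Structure 𝕄] (κ : Cardinal.{u}) : Prop :=
  Cardinal.aleph0 < κ ∧ IsSaturated L 𝕄 κ ∧ IsStronglyHomogeneous L 𝕄 κ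

/-! ### Tree combinatorics -/

/-- The meet (longest common prefix) of two finite sequences. -/
def meet {A : Type w} [DecidableEq A] : List A → List A → List A
  | a :: as, b :: bs => if a = b then a :: meet as bs else []
  | _, _ => []

/-- The meet of `η 0, …, η i`. -/
def combMeet {A : Type w} [DecidableEq A] {k : ℕ} (η : Fin k → List A) (i : Fin k) : List A :=
  (List.ofFn fun j : Fin i.val => η (Fin.castLE i.2.le j)).foldl meet (η i)

/-- `η 0, …, η (k-1)` is a descending comb: a lexicographically increasing
antichain such that the meet of `η 0, …, η (i+1)` is a proper initial segment
of the meet of `η 0, …, η i`. -/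
def DescendingComb {A : Type w} [DecidableEq A] [LT A] {k : ℕ} (η : Fin k → List A) : Prop :=
  (∀ i j : Fin k, i ≠ j → ¬ η i <+: η j) ∧
  (∀ i j : Fin k, i < j → List.Lex (· < ·) (η i) (η j)) ∧
  (∀ (i : ℕ) (h : i + 1 < k),
    combMeet η ⟨i + 1, h⟩ <+: combMeet η ⟨i, by omega⟩ ∧
    combMeet η ⟨i + 1, h⟩ ≠ combMeet η ⟨i, by omega⟩)

/-! ### Tree properties of theories (witnessed in the monster model) -/

/-- `T = Th(𝕄)` has `SOP₁`. -/
def HasSOP1 (L : FirstOrder.Language.{u, u}) (𝕄 : Type u) [L.Structure 𝕄] : Prop :=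
  ∃ (k m : ℕ) (φ : L.Formula (Fin k ⊕ Fin m)) (b : List Bool → Fin m → 𝕄),
    (∀ σ : ℕ → Bool, ∃ a : Fin k → 𝕄,
      ∀ n : ℕ, φ.Realize (Sum.elim a (b (List.ofFn fun i : Fin n => σ i)))) ∧
    ∀ η₁ η₂ : List Bool, (η₁ ++ [false]) <+: η₂ →
      ¬ ∃ a : Fin k → 𝕄, φ.Realize (Sum.elim a (b η₂)) ∧
        φ.Realize (Sum.elim a (b (η₁ ++ [true])))

/-- `T = Th(𝕄)` has `SOP₂`. -/
def HasSOP2 (L : FirstOrder.Language.{u, u}) (𝕄 : Type u) [L.Structure 𝕄] : Prop :=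
  ∃ (k m : ℕ) (φ : L.Formula (Fin k ⊕ Fin m)) (b : List Bool → Fin m → 𝕄),
    (∀ σ : ℕ → Bool, ∃ a : Fin k → 𝕄,
      ∀ n : ℕ, φ.Realize (Sum.elim a (b (List.ofFn fun i : Fin n => σ i)))) ∧
    ∀ η₁ η₂ : List Bool, ¬ η₁ <+: η₂ → ¬ η₂ <+: η₁ →
      ¬ ∃ a : Fin k → 𝕄, φ.Realize (Sum.elim a (b η₁)) ∧ φ.Realize (Sum.elim a (b η₂))

/-- `T = Th(𝕄)` has `k`-`DCTP₁`: paths are consistent but descending combs of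
size `k` are inconsistent. -/
def HasKDCTP1 (L : FirstOrder.Language.{u, u}) (𝕄 : Type u) [L.Structure 𝕄] (k : ℕ) : Prop :=
  ∃ (r m : ℕ) (φ : L.Formula (Fin r ⊕ Fin m)) (b : List ℕ → Fin m → 𝕄),
    (∀ σ : ℕ → ℕ, ∃ a : Fin r → 𝕄,
      ∀ n : ℕ, φ.Realize (Sum.elim a (b (List.ofFn fun i : Fin n => σ i)))) ∧
    ∀ η : Fin k → List ℕ, DescendingComb η →
      ¬ ∃ a : Fin r → 𝕄, ∀ i, φ.Realize (Sum.elim a (b (η i)))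

/-- `T = Th(𝕄)` has weak `k`-`TP₁`: paths are consistent but any `k` pairwise
incomparable nodes with common pairwise meet are inconsistent. -/
def HasWeakKTP1 (L : FirstOrder.Language.{u, u}) (𝕄 : Type u) [L.Structure 𝕄] (k : ℕ) : Prop :=
  ∃ (r m : ℕ) (φ : L.Formula (Fin r ⊕ Fin m)) (b : List ℕ → Fin m → 𝕄),
    (∀ σ : ℕ → ℕ, ∃ a : Fin r → 𝕄,
      ∀ n : ℕ, φ.Realize (Sum.elim a (b (List.ofFn fun i : Fin n => σ i)))) ∧
    ∀ η : Fin k → List ℕ,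
      (∀ i j, i ≠ j → ¬ η i <+: η j) →
      (∀ i j i' j' : Fin k, i ≠ j → i' ≠ j' → meet (η i) (η j) = meet (η i') (η j')) →
      ¬ ∃ a : Fin r → 𝕄, ∀ i, φ.Realize (Sum.elim a (b (η i)))

/-- `T = Th(𝕄)` has `k`-`DCTP₂`: paths are `k`-inconsistent but descending
combs are consistent. -/
def HasKDCTP2 (L : FirstOrder.Language.{u, u}) (𝕄 : Type u) [L.Structure 𝕄] (k : ℕ) : Prop :=
  ∃ (r m : ℕ) (φ : L.Formula (Fin r ⊕ Fin m)) (b : List Bool → Fin m → 𝕄),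
    (∀ σ : ℕ → Bool, ∀ s : Finset ℕ, s.card = k →
      ¬ ∃ a : Fin r → 𝕄, ∀ n ∈ s,
        φ.Realize (Sum.elim a (b (List.ofFn fun i : Fin n => σ i)))) ∧
    ∀ (l : ℕ) (η : Fin l → List Bool), DescendingComb η →
      ∃ a : Fin r → 𝕄, ∀ i, φ.Realize (Sum.elim a (b (η i)))

/-! ### Kim-dividing and Conant-dividing, with respect to coheir Morley sequences -/

/-- `φ(x, b)` Kim-divides over `Ms`: some coheir Morley sequence over `Ms`
starting with `b` makes it inconsistent. -/
def KimDivides (L : FirstOrder.Language.{u, u}) {𝕄 : Type u} [L.Structure 𝕄] (Ms : Set 𝕄)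
    {α : Type v} {n : ℕ} (φ : L.Formula (α ⊕ Fin n)) (b : Fin n → 𝕄) : Prop :=
  ∃ B : ℕ → Fin n → 𝕄, CoheirMorley L Ms B ∧ B 0 = b ∧
    ¬ ∃ a : α → 𝕄, ∀ i, φ.Realize (Sum.elim a (B i))

/-- `φ(x, b)` Kim-forks over `Ms`: it implies a finite disjunction of formulas
Kim-dividing over `Ms`. -/
def KimForks (L : FirstOrder.Language.{u, u}) {𝕄 : Type u} [L.Structure 𝕄] (Ms : Set 𝕄)
    {α : Type v} {n : ℕ} (φ : L.Formula (α ⊕ Fin n)) (b : Fin n → 𝕄) : Prop :=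
  ∃ (N : ℕ) (m : Fin N → ℕ) (ψ : ∀ j : Fin N, L.Formula (α ⊕ Fin (m j)))
    (c : ∀ j : Fin N, Fin (m j) → 𝕄),
    (∀ j, KimDivides L Ms (ψ j) (c j)) ∧
    ∀ a : α → 𝕄, φ.Realize (Sum.elim a b) → ∃ j, (ψ j).Realize (Sum.elim a (c j))

/-- `φ(x, b)` Conant-divides over `Ms`: every coheir Morley sequence over `Ms`
starting with `b` makes it inconsistent. -/
def ConantDivides (L : FirstOrder.Language.{u, u}) {𝕄 : Type u} [L.Structure 𝕄] (Ms : Set 𝕄)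
    {α : Type v} {n : ℕ} (φ : L.Formula (α ⊕ Fin n)) (b : Fin n → 𝕄) : Prop :=
  ∀ B : ℕ → Fin n → 𝕄, CoheirMorley L Ms B → B 0 = b →
    ¬ ∃ a : α → 𝕄, ∀ i, φ.Realize (Sum.elim a (B i))

/-- `φ(x, b)` Conant-forks over `Ms`. -/
def ConantForks (L : FirstOrder.Language.{u, u}) {𝕄 : Type u} [L.Structure 𝕄] (Ms : Set 𝕄)
    {α : Type v} {n : ℕ} (φ : L.Formula (α ⊕ Fin n)) (b : Fin n → 𝕄) : Prop :=
  ∃ (N : ℕ) (m : Fin N → ℕ) (ψ : ∀ j : Fin N, L.Formula (α ⊕ Fin (m j)))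
    (c : ∀ j : Fin N, Fin (m j) → 𝕄),
    (∀ j, ConantDivides L Ms (ψ j) (c j)) ∧
    ∀ a : α → 𝕄, φ.Realize (Sum.elim a b) → ∃ j, (ψ j).Realize (Sum.elim a (c j))

/-- `a ⫝^{K*}_{Ms} b` : `tp(a/Ms b)` contains no formula Conant-forking
over `Ms`. -/
def ConantIndep (L : FirstOrder.Language.{u, u}) {𝕄 : Type u} [L.Structure 𝕄] (Ms : Set 𝕄)
    {α : Type v} {β : Type w} (a : α → 𝕄) (b : β → 𝕄) : Prop :=
  ∀ (n : ℕ) (φ : L.Formula (α ⊕ Fin n)) (d : Fin n → 𝕄),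
    (∀ i, d i ∈ Ms ∪ Set.range b) → φ.Realize (Sum.elim a d) →
    ¬ ConantForks L Ms φ d

/-! ### Abstract independence relations between sets over models -/

/-- An abstract ternary relation `A ⫝_M B` between subsets of `𝕄` over
(elementary submodels of) `𝕄`. -/
structure IndRel (L : FirstOrder.Language.{u, u}) (𝕄 : Type u) [L.Structure 𝕄] where
  rel : Set 𝕄 → Set 𝕄 → Set 𝕄 → Prop

/-- A set `S` of `α`-tuples is type-definable over `C`. -/
def TypeDefinableOver (L : FirstOrder.Language.{u, u}) {𝕄 : Type u} [L.Structure 𝕄] (C : Set 𝕄)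
    {γ : Type v} (S : Set (γ → 𝕄)) : Prop :=
  ∃ Γ : Set (FmlP L 𝕄 γ), (∀ p ∈ Γ, ∀ i, p.2.2 i ∈ C) ∧
    ∀ g : γ → 𝕄, g ∈ S ↔ ∀ p ∈ Γ, p.2.1.Realize (Sum.elim g p.2.2)

namespace IndRel


/-- Invariance under automorphisms of `𝕄`. -/
def Invariant (R : IndRel L 𝕄) : Prop :=
  ∀ (σ : 𝕄 ≃[L] 𝕄) (A Ms B : Set 𝕄), R.rel A Ms B →
    R.rel ((⇑σ) '' A) ((⇑σ) '' Ms) ((⇑σ) '' B)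

/-- Monotonicity (on both sides). -/
def Mono (R : IndRel L 𝕄) : Prop :=
  ∀ (A A' Ms B B' : Set 𝕄), IsElemSubmodel L Ms → R.rel A Ms B →
    Ms ⊆ A' → A' ⊆ A → Ms ⊆ B' → B' ⊆ B → R.rel A' Ms B'

/-- Existence: for `M ⊆ A, B` there is `A' ≡_M A` with `A' ⫝_M B`. -/
def Existence (R : IndRel L 𝕄) (κ : Cardinal.{u}) : Prop :=
  ∀ (Ms : Set 𝕄), IsElemSubmodel L Ms → Cardinal.mk Ms < κ →
    ∀ (α β : Type u), Cardinal.mk α < κ → Cardinal.mk β < κ →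
      ∀ (a : α → 𝕄) (b : β → 𝕄),
        ∃ a' : α → 𝕄, EqTpOver L Ms a' a ∧
          R.rel (Ms ∪ Set.range a') Ms (Ms ∪ Set.range b)

/-- Right extension. -/
def RightExt (R : IndRel L 𝕄) (κ : Cardinal.{u}) : Prop :=
  ∀ (Ms : Set 𝕄), IsElemSubmodel L Ms → Cardinal.mk Ms < κ →
    ∀ (α : Type u), Cardinal.mk α < κ → ∀ (a : α → 𝕄) (B C : Set 𝕄),
      Cardinal.mk B < κ → Cardinal.mk C < κ →
      R.rel (Set.range a) Ms B → B ⊆ C →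
      ∃ a' : α → 𝕄, EqTpOver L B a' a ∧ R.rel (Set.range a') Ms C

/-- Quasi-strong finite character: for complete types `p = tp(a₀/Ms)` and
`q = tp(b₀/Ms)`, the set of pairs of realizations `(a, b)` with `a ⫝_Ms b`
is type-definable over `Ms`. -/
def QSFC (R : IndRel L 𝕄) (κ : Cardinal.{u}) : Prop :=
  ∀ (Ms : Set 𝕄), IsElemSubmodel L Ms → Cardinal.mk Ms < κ →
    ∀ (α β : Type u), Cardinal.mk α < κ → Cardinal.mk β < κ →
      ∀ (a₀ : α → 𝕄) (b₀ : β → 𝕄),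
        TypeDefinableOver L Ms {g : (α ⊕ β) → 𝕄 |
          EqTpOver L Ms (g ∘ Sum.inl) a₀ ∧ EqTpOver L Ms (g ∘ Sum.inr) b₀ ∧
          R.rel (Set.range (g ∘ Sum.inl)) Ms (Set.range (g ∘ Sum.inr))}

/-- The coheir chain condition. -/
def CoheirChain (R : IndRel L 𝕄) (κ : Cardinal.{u}) : Prop :=
  ∀ (Ms : Set 𝕄), IsElemSubmodel L Ms → Cardinal.mk Ms < κ →
    ∀ (α β : Type u), Cardinal.mk α < κ → Cardinal.mk β < κ →
      ∀ (a : α → 𝕄) (b : β → 𝕄), R.rel (Set.range a) Ms (Set.range b) →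
        ∀ I : ℕ → β → 𝕄, CoheirMorley L Ms I → I 0 = b →
          ∃ I' : ℕ → β → 𝕄, EqTpOver L Ms (flatSeq I') (flatSeq I) ∧
            R.rel (Set.range a) Ms (⋃ i, Set.range (I' i)) ∧
            ∀ i, EqTpOver L (Ms ∪ Set.range a) (I' i) b

/-- `R` implies `⫝ʰ` : `A ⫝_M B` implies `tp(B / M A)` is finitely
satisfiable in `M`. -/
def StrongerThanH (R : IndRel L 𝕄) : Prop :=
  ∀ (A Ms B : Set 𝕄), IsElemSubmodel L Ms → R.rel A Ms B →
    FinSatIn L Ms (fun x : B => (x : 𝕄)) (Ms ∪ A)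

end IndRel

/-- The axioms satisfied by the relations among which `⫝^CK` is weakest. -/
def GoodRel (R : IndRel L 𝕄) (κ : Cardinal.{u}) : Prop :=
  R.StrongerThanH ∧ R.Invariant ∧ R.Mono ∧ R.Existence κ ∧ R.RightExt κ ∧ R.CoheirChain κ

/-- `R` is `⫝^CK` : the weakest relation implying `⫝ʰ` and satisfying
invariance, monotonicity, existence, right extension and the coheir chain
condition. -/
def IsCK (R : IndRel L 𝕄) (κ : Cardinal.{u}) : Prop :=
  GoodRel R κ ∧ ∀ R' : IndRel L 𝕄, GoodRel R' κ →
    ∀ A Ms B : Set 𝕄, R'.rel A Ms B → R.rel A Ms B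

/-- `q` is a canonical global type over `Ms` (w.r.t. the relation `R = ⫝^CK`):
whenever `c ⊨ q|_{Ms b}` we have `b ⫝^CK_{Ms} c`. -/
def IsCanonicalGlobal (R : IndRel L 𝕄) (κ : Cardinal.{u}) (Ms : Set 𝕄) {α : Type v}
    (q : GlobalType L 𝕄 α) : Prop :=
  ∀ (β : Type u), Cardinal.mk β < κ → ∀ (b : β → 𝕄) (c : α → 𝕄),
    RealizesType q c (Ms ∪ Set.range b) → R.rel (Set.range b) Ms (Set.range c)

/-- A canonical Morley sequence over `Ms`: a coheir Morley sequence in a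
canonical coheir. -/
def CanonicalMorley (R : IndRel L 𝕄) (κ : Cardinal.{u}) (Ms : Set 𝕄) {α : Type v}
    (I : ℕ → α → 𝕄) : Prop :=
  ∃ q : GlobalType L 𝕄 α, IsCanonicalGlobal R κ Ms q ∧ MorleyIn q Ms I

/-- `q` is a strong canonical global type over `Ms`. -/
def IsStrongCanonical (R : IndRel L 𝕄) (κ : Cardinal.{u}) (Ms : Set 𝕄) {α : Type v}
    (q : GlobalType L 𝕄 α) : Prop :=
  ∀ (β : Type u), Cardinal.mk β < κ → ∀ (b : β → 𝕄) (c : α → 𝕄),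
    RealizesType q c (Ms ∪ Set.range b) →
    ∀ (γ : Type u), Cardinal.mk γ < κ → ∀ (a : γ → 𝕄),
      ∃ a' : γ → 𝕄, EqTpOver L (Ms ∪ Set.range c) a' a ∧
        ∃ q' : GlobalType L 𝕄 (γ ⊕ α), IsCanonicalGlobal R κ Ms q' ∧
          ExtendsTpOver q' (Ms ∪ Set.range b) (Sum.elim a' c)

/-! ### `M`-invariant ideals and `𝓘`-Kim-dividing -/

/-- An `Ms`-invariant ideal on the definable subsets of `𝕄` (in variables `α`). -/
structure InvIdeal (L : FirstOrder.Language.{u, u}) (𝕄 : Type u) [L.Structure 𝕄] (Ms : Set 𝕄)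
    (α : Type v) where
  mem : Set (α → 𝕄) → Prop
  definable_of_mem : ∀ S, mem S → ∃ (n : ℕ) (ψ : L.Formula (α ⊕ Fin n)) (c : Fin n → 𝕄),
    S = {a : α → 𝕄 | ψ.Realize (Sum.elim a c)}
  union_mem : ∀ S T, mem S → mem T → mem (S ∪ T)
  subset_mem : ∀ S T, mem S →
    (∃ (n : ℕ) (ψ : L.Formula (α ⊕ Fin n)) (c : Fin n → 𝕄),
      T = {a : α → 𝕄 | ψ.Realize (Sum.elim a c)}) →
    T ⊆ S → mem T
  invariant : ∀ σ : 𝕄 ≃[L] 𝕄, (∀ x ∈ Ms, σ x = x) → ∀ S, mem S →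
    mem ((fun a => (⇑σ) ∘ a) '' S)

/-- `φ(x, b)` `𝓘`-Kim-divides over `Ms`. -/
def IKimDivides {Ms : Set 𝕄} {α : Type v} (I : InvIdeal L 𝕄 Ms α) {n : ℕ}
    (φ : L.Formula (α ⊕ Fin n)) (b : Fin n → 𝕄) : Prop :=
  ∃ (B : ℕ → Fin n → 𝕄) (k : ℕ), CoheirMorley L Ms B ∧ B 0 = b ∧ 0 < k ∧
    ∀ s : Finset ℕ, s.card = k →
      I.mem {a : α → 𝕄 | ∀ i ∈ s, φ.Realize (Sum.elim a (B i))}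

/-- `φ(x, b)` `𝓘`-Kim-forks over `Ms`. -/
def IKimForks {Ms : Set 𝕄} {α : Type v} (I : InvIdeal L 𝕄 Ms α) {n : ℕ}
    (φ : L.Formula (α ⊕ Fin n)) (b : Fin n → 𝕄) : Prop :=
  ∃ (N : ℕ) (m : Fin N → ℕ) (ψ : ∀ j : Fin N, L.Formula (α ⊕ Fin (m j)))
    (c : ∀ j : Fin N, Fin (m j) → 𝕄),
    (∀ j, IKimDivides I (ψ j) (c j)) ∧
    ∀ a : α → 𝕄, φ.Realize (Sum.elim a b) → ∃ j, (ψ j).Realize (Sum.elim a (c j))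

/-- `φ(x, b)` `𝓘`-quasi-divides over `Ms`. -/
def IQuasiDivides {Ms : Set 𝕄} {α : Type v} (I : InvIdeal L 𝕄 Ms α) {n : ℕ}
    (φ : L.Formula (α ⊕ Fin n)) (b : Fin n → 𝕄) : Prop :=
  ∃ (mm : ℕ) (b' : Fin mm → Fin n → 𝕄), 0 < mm ∧ (∀ j, EqTpOver L Ms (b' j) b) ∧
    I.mem {a : α → 𝕄 | ∀ j, φ.Realize (Sum.elim a (b' j))}

/-! ### `h^⫝`-inconsistency and the derived relation `⫝'` -/

/-- A family of formulas is `h^⫝`-inconsistent with respect to `P = tp(a₀/Ms)`. -/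
def HInconsistent (R : IndRel L 𝕄) (Ms : Set 𝕄) {α : Type v} (a₀ : α → 𝕄)
    {ι : Type w} (m : ι → ℕ) (φ : ∀ i : ι, L.Formula (α ⊕ Fin (m i)))
    (b : ∀ i : ι, Fin (m i) → 𝕄) : Prop :=
  ¬ ∃ a : α → 𝕄, EqTpOver L Ms a a₀ ∧
      R.rel (Set.range a) Ms (⋃ i, Set.range (b i)) ∧
      ∀ i, (φ i).Realize (Sum.elim a (b i))

/-- A single formula is `h^⫝`-inconsistent with respect to `P = tp(a₀/Ms)`. -/
def HInconsistentSingle (R : IndRel L 𝕄) (Ms : Set 𝕄) {α : Type v} (a₀ : α → 𝕄)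
    {n : ℕ} (φ : L.Formula (α ⊕ Fin n)) (b : Fin n → 𝕄) : Prop :=
  ¬ ∃ a : α → 𝕄, EqTpOver L Ms a a₀ ∧ R.rel (Set.range a) Ms (Set.range b) ∧
      φ.Realize (Sum.elim a b)

/-- `φ(x, b)` `h^⫝`-Kim-divides with respect to `tp(a₀/Ms)`. -/
def HKimDivides (R : IndRel L 𝕄) (Ms : Set 𝕄) {α : Type v} (a₀ : α → 𝕄)
    {n : ℕ} (φ : L.Formula (α ⊕ Fin n)) (b : Fin n → 𝕄) : Prop :=
  ∃ B : ℕ → Fin n → 𝕄, CoheirMorley L Ms B ∧ B 0 = b ∧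
    HInconsistent R Ms a₀ (fun _ : ℕ => n) (fun _ => φ) B

/-- `φ(x, b)` `h^⫝`-Kim-forks with respect to `tp(a₀/Ms)`. -/
def HKimForks (R : IndRel L 𝕄) (Ms : Set 𝕄) {α : Type v} (a₀ : α → 𝕄)
    {n : ℕ} (φ : L.Formula (α ⊕ Fin n)) (b : Fin n → 𝕄) : Prop :=
  ∃ (N : ℕ) (m : Fin N → ℕ) (ψ : ∀ j : Fin N, L.Formula (α ⊕ Fin (m j)))
    (c : ∀ j : Fin N, Fin (m j) → 𝕄),
    (∀ j, HKimDivides R Ms a₀ (ψ j) (c j)) ∧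
    ∀ a : α → 𝕄, φ.Realize (Sum.elim a b) → ∃ j, (ψ j).Realize (Sum.elim a (c j))

/-- `φ(x, b)` `h^⫝`-quasi-divides with respect to `tp(a₀/Ms)`. -/
def HQuasiDivides (R : IndRel L 𝕄) (Ms : Set 𝕄) {α : Type v} (a₀ : α → 𝕄)
    {n : ℕ} (φ : L.Formula (α ⊕ Fin n)) (b : Fin n → 𝕄) : Prop :=
  ∃ (mm : ℕ) (b' : Fin mm → Fin n → 𝕄), 0 < mm ∧ (∀ j, EqTpOver L Ms (b' j) b) ∧
    HInconsistent R Ms a₀ (fun _ : Fin mm => n) (fun _ => φ) b'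

/-- The derived relation `⫝'` on tuples:
`tp(a / Ms b)` contains no formula `h^⫝`-Kim-forking w.r.t. `tp(a/Ms)`. -/
def DerivedIndep (R : IndRel L 𝕄) (Ms : Set 𝕄) {α : Type v} {β : Type w}
    (a : α → 𝕄) (b : β → 𝕄) : Prop :=
  ∀ (n : ℕ) (φ : L.Formula (α ⊕ Fin n)) (d : Fin n → 𝕄),
    (∀ i, d i ∈ Ms ∪ Set.range b) → φ.Realize (Sum.elim a d) →
    ¬ HKimForks R Ms a φ d

/-- The derived relation `⫝'` as a relation between sets over models. -/
def derived (R : IndRel L 𝕄) : IndRel L 𝕄 where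
  rel A Ms B := ∀ (n : ℕ) (φ : L.Formula (↥A ⊕ Fin n)) (d : Fin n → 𝕄),
    (∀ i, d i ∈ Ms ∪ B) → φ.Realize (Sum.elim (fun x : A => (x : 𝕄)) d) →
    ¬ HKimForks R Ms (fun x : A => (x : 𝕄)) φ d

/-! ### Coheir trees -/

/-- The tuple, indexed by extensions, consisting of the part of the tree `c`
lying (weakly) above the node `ν` (where `ν` has length `Lh`). -/
def subtreeTupleLen {α : Type v} {n : ℕ} (c : {l : List ℕ // l.length ≤ n} → α → 𝕄)
    (Lh : ℕ) (ν : List ℕ) (hν : ν.length = Lh) :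
    ({s : List ℕ // Lh + s.length ≤ n} × α) → 𝕄 :=
  fun p => c ⟨ν ++ p.1.1, by rw [List.length_append, hν]; exact p.1.2⟩ p.2

end NSOP2Paper

namespace NSOP2Paper

/-! ### Embeddings of the tree `ω^{<ω}` -/

/-- `g` preserves meets, and the order of the immediate successors of a node. -/
def TreeEmb (g : List ℕ → List ℕ) : Prop :=
  ∀ η, ∃ s : ℕ → ℕ, StrictMono s ∧ ∀ i τ, g η ++ [s i] <+: g (η ++ i :: τ)

/-- A list of nodes that is strictly increasing in the tree order. -/
def IsTreeChain (l : List (List ℕ)) : Prop :=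
  l.Pairwise fun p q => p <+: q ∧ p ≠ q

theorem eq_or_exists_append_cons {A : Type*} {a b : List A} (h : a <+: b) :
    a = b ∨ ∃ i τ, b = a ++ i :: τ := by
  obtain ⟨t, rfl⟩ := h
  cases t with
  | nil => simp
  | cons i τ => exact .inr ⟨i, τ, rfl⟩

theorem exists_split_of_incomparable {A : Type*} (a b : List A) (h₁ : ¬ a <+: b)
    (h₂ : ¬ b <+: a) :
    ∃ ν i j τ τ', i ≠ j ∧ a = ν ++ i :: τ ∧ b = ν ++ j :: τ' := by
  induction a generalizing b with
  | nil => exact absurd (List.nil_prefix) h₁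
  | cons x a ih =>
    cases b with
    | nil => exact absurd (List.nil_prefix) h₂
    | cons y b =>
      by_cases hxy : x = y
      · subst hxy
        obtain ⟨ν, i, j, τ, τ', hij, rfl, rfl⟩ := ih b (by simpa using h₁) (by simpa using h₂)
        exact ⟨x :: ν, i, j, τ, τ', hij, rfl, rfl⟩
      · exact ⟨[], x, y, a, b, hxy, rfl, rfl⟩

theorem lex_iff_split {A : Type*} [LT A] {a b : List A} (hab : ¬ a <+: b) :
    List.Lex (· < ·) a b ↔ ∃ ν i j τ τ', i < j ∧ a = ν ++ i :: τ ∧ b = ν ++ j :: τ' := by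
  constructor
  · intro h
    induction h with
    | nil => exact absurd List.nil_prefix hab
    | @rel x a y b hxy => exact ⟨[], x, y, a, b, hxy, rfl, rfl⟩
    | @cons x a b _ ih =>
      obtain ⟨ν, i, j, τ, τ', hij, rfl, rfl⟩ := ih (by simpa using hab)
      exact ⟨x :: ν, i, j, τ, τ', hij, rfl, rfl⟩
  · rintro ⟨ν, i, j, τ, τ', hij, rfl, rfl⟩
    clear hab
    induction ν with
    | nil => exact .rel hij
    | cons x ν ih => exact .cons ih

theorem prefix_meet_iff {A : Type*} [DecidableEq A] {p a b : List A} :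
    p <+: meet a b ↔ p <+: a ∧ p <+: b := by
  induction a generalizing p b with
  | nil => cases b <;> simp +contextual [meet]
  | cons x a ih =>
    cases b with
    | nil => simp +contextual [meet]
    | cons y b =>
      cases p with
      | nil => simp
      | cons z p =>
        by_cases hxy : x = y
        · subst hxy
          simp [meet, ih]
          tauto
        · simp only [meet, hxy, if_false, List.cons_prefix_cons]
          simp
          rintro rfl _ rfl
          exact absurd rfl hxy

theorem prefix_foldl_meet_iff {A : Type*} [DecidableEq A] {p a : List A} {l : List (List A)} :
    p <+: l.foldl meet a ↔ p <+: a ∧ ∀ b ∈ l, p <+: b := by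
  induction l generalizing a with
  | nil => simp
  | cons b l ih => simp [ih, prefix_meet_iff, and_assoc]

theorem prefix_combMeet_iff {A : Type*} [DecidableEq A] {k : ℕ} {η : Fin k → List A} {i : Fin k}
    {p : List A} : p <+: combMeet η i ↔ ∀ j ≤ i, p <+: η j := by
  rw [combMeet, prefix_foldl_meet_iff]
  simp only [List.mem_ofFn, forall_exists_index, forall_apply_eq_imp_iff]
  constructor
  · rintro ⟨h₁, h₂⟩ j hj
    rcases hj.eq_or_lt with rfl | hj
    · exact h₁
    · exact h₂ ⟨j, hj⟩
  · intro h
    exact ⟨h i le_rfl, fun j => h _ (Fin.le_def.2 j.2.le)⟩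

theorem eq_of_prefix_iff {A : Type*} {a b : List A} (h : ∀ p, p <+: a ↔ p <+: b) : a = b :=
  ((h a).1 List.prefix_rfl).eq_of_length_le (((h b).2 List.prefix_rfl).length_le)

theorem meet_split {A : Type*} [DecidableEq A] (ν : List A) {i j : A} (hij : i ≠ j)
    (τ τ' : List A) : meet (ν ++ i :: τ) (ν ++ j :: τ') = ν := by
  induction ν with
  | nil => simp [meet, hij]
  | cons x ν ih => simpa [meet] using ih

theorem meet_eq_left {A : Type*} [DecidableEq A] {a b : List A} (h : a <+: b) : meet a b = a :=
  eq_of_prefix_iff fun p => by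
    rw [prefix_meet_iff]
    exact ⟨And.left, fun hp => ⟨hp, hp.trans h⟩⟩

theorem meet_comm {A : Type*} [DecidableEq A] (a b : List A) : meet a b = meet b a :=
  eq_of_prefix_iff fun p => by simp only [prefix_meet_iff, and_comm]

namespace TreeEmb

variable {g h : List ℕ → List ℕ}

theorem id : TreeEmb id := fun η => ⟨fun i => i, strictMono_id, fun i τ => by simp⟩

theorem append_left (ν : List ℕ) : TreeEmb (ν ++ ·) :=
  fun η => ⟨fun i => i, strictMono_id, fun i τ => by simp⟩

theorem cons (i : ℕ) : TreeEmb (i :: ·) := append_left [i]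

theorem split (hg : TreeEmb g) (ν : List ℕ) {i j : ℕ} (hij : i < j) (τ τ' : List ℕ) :
    ∃ i' j' ρ ρ', i' < j' ∧ g (ν ++ i :: τ) = g ν ++ i' :: ρ ∧
      g (ν ++ j :: τ') = g ν ++ j' :: ρ' := by
  obtain ⟨s, hs, h⟩ := hg ν
  obtain ⟨ρ, hρ⟩ := h i τ
  obtain ⟨ρ', hρ'⟩ := h j τ'
  exact ⟨s i, s j, ρ, ρ', hs hij, by simp [← hρ], by simp [← hρ']⟩

theorem comp (hg : TreeEmb g) (hh : TreeEmb h) : TreeEmb (g ∘ h) := by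
  intro η
  obtain ⟨s, hs, hs'⟩ := hh η
  obtain ⟨t, ht, ht'⟩ := hg (h η)
  refine ⟨t ∘ s, ht.comp hs, fun i τ => ?_⟩
  obtain ⟨ρ, hρ⟩ := hs' i τ
  have := ht' (s i) ρ
  simpa [← hρ] using this

theorem mono (hg : TreeEmb g) {a b : List ℕ} (hab : a <+: b) : g a <+: g b := by
  rcases eq_or_exists_append_cons hab with rfl | ⟨i, τ, rfl⟩
  · exact List.prefix_rfl
  · obtain ⟨s, -, h⟩ := hg a
    exact (List.prefix_append _ _).trans (h i τ)

theorem ne (hg : TreeEmb g) {a b : List ℕ} (hab : a <+: b) (hne : a ≠ b) : g a ≠ g b := by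
  rcases eq_or_exists_append_cons hab with rfl | ⟨i, τ, rfl⟩
  · exact absurd rfl hne
  · obtain ⟨s, -, h⟩ := hg a
    intro he
    have := (h i τ).length_le
    simp [← he] at this

theorem map_meet (hg : TreeEmb g) (a b : List ℕ) : meet (g a) (g b) = g (meet a b) := by
  by_cases h₁ : a <+: b
  · rw [meet_eq_left h₁, meet_eq_left (hg.mono h₁)]
  by_cases h₂ : b <+: a
  · rw [meet_comm, meet_comm a, meet_eq_left h₂, meet_eq_left (hg.mono h₂)]
  obtain ⟨ν, i, j, τ, τ', hij, rfl, rfl⟩ := exists_split_of_incomparable a b h₁ h₂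
  rw [meet_split _ hij]
  rcases hij.lt_or_gt with hij | hij
  · obtain ⟨i', j', ρ, ρ', hij', e, e'⟩ := hg.split ν hij τ τ'
    rw [e, e', meet_split _ hij'.ne]
  · obtain ⟨i', j', ρ, ρ', hij', e, e'⟩ := hg.split ν hij τ' τ
    rw [e, e', meet_split _ hij'.ne']

theorem combMeet_comp (hg : TreeEmb g) {k : ℕ} (η : Fin k → List ℕ) (i : Fin k) :
    combMeet (g ∘ η) i = g (combMeet η i) := by
  have key : ∀ (l : List (List ℕ)) a, (l.map g).foldl meet (g a) = g (l.foldl meet a) := by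
    intro l
    induction l with
    | nil => simp
    | cons b l ih => intro a; simp [hg.map_meet, ih]
  rw [combMeet, combMeet, ← key, List.map_ofFn]
  rfl

theorem not_prefix (hg : TreeEmb g) {a b : List ℕ} (h₁ : ¬ a <+: b) (h₂ : ¬ b <+: a) :
    ¬ g a <+: g b := by
  intro h
  obtain ⟨ν, i, j, τ, τ', hij, rfl, rfl⟩ := exists_split_of_incomparable a b h₁ h₂
  rcases hij.lt_or_gt with hij | hij
  · obtain ⟨i', j', ρ, ρ', hij', e, e'⟩ := hg.split ν hij τ τ'
    rw [e, e'] at h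
    simp [hij'.ne] at h
  · obtain ⟨i', j', ρ, ρ', hij', e, e'⟩ := hg.split ν hij τ' τ
    rw [e, e'] at h
    simp [hij'.ne'] at h

theorem descendingComb (hg : TreeEmb g) {k : ℕ} {η : Fin k → List ℕ} (hη : DescendingComb η) :
    DescendingComb (g ∘ η) := by
  obtain ⟨h₁, h₂, h₃⟩ := hη
  refine ⟨fun i j hij => hg.not_prefix (h₁ i j hij) (h₁ j i hij.symm), fun i j hij => ?_, ?_⟩
  · have hnp := h₁ i j hij.ne
    obtain ⟨ν, x, y, τ, τ', hxy, e, e'⟩ := (lex_iff_split hnp).1 (h₂ i j hij)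
    refine (lex_iff_split (hg.not_prefix hnp (h₁ j i hij.ne'))).2 ?_
    obtain ⟨i', j', ρ, ρ', hij', e₁, e₂⟩ := hg.split ν hxy τ τ'
    exact ⟨g ν, i', j', ρ, ρ', hij', by simp [e, e₁], by simp [e', e₂]⟩
  · intro i hi
    rw [hg.combMeet_comp, hg.combMeet_comp]
    exact ⟨hg.mono (h₃ i hi).1, hg.ne (h₃ i hi).1 (h₃ i hi).2⟩

theorem isTreeChain_map (hg : TreeEmb g) {l : List (List ℕ)} (hl : IsTreeChain l) :
    IsTreeChain (l.map g) := by
  rw [IsTreeChain, List.pairwise_map]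
  exact hl.imp fun h => ⟨hg.mono h.1, hg.ne h.1 h.2⟩

end TreeEmb

theorem not_prefix_of_split {A : Type*} {ν p q : List A} {i j : A} (hij : i ≠ j)
    (hp : ν ++ [i] <+: p) (hq : ν ++ [j] <+: q) : ¬ p <+: q := by
  intro h
  obtain ⟨t, ht⟩ := List.prefix_of_prefix_length_le (hp.trans h) hq (by simp)
  simp [hij] at ht

/-- A descending comb inside a cone extends by a node branching off to the right of that cone. -/
theorem DescendingComb.snoc {k : ℕ} {η : Fin k → List ℕ} (hη : DescendingComb η) {ν c : List ℕ}
    {i j : ℕ} (hij : i < j) (hηi : ∀ x, ν ++ [i] <+: η x) (hc : ν ++ [j] <+: c) :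
    DescendingComb (Fin.snoc η c : Fin (k + 1) → List ℕ) := by
  obtain ⟨h₁, h₂, h₃⟩ := hη
  refine ⟨fun x y => ?_, fun x y => ?_, fun x hx => ?_⟩
  · refine Fin.lastCases ?_ (fun x => ?_) x <;> refine Fin.lastCases ?_ (fun y => ?_) y
    · simp
    · intro _
      simpa using not_prefix_of_split hij.ne' hc (hηi y)
    · intro _
      simpa using not_prefix_of_split hij.ne (hηi x) hc
    · intro hxy
      simpa using h₁ x y (by simpa using hxy)
  · refine Fin.lastCases ?_ (fun x => ?_) x <;> refine Fin.lastCases ?_ (fun y => ?_) y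
    · simp
    · intro h
      exact absurd h (Fin.le_last _).not_gt
    · intro _
      obtain ⟨ρ, hρ⟩ := hηi x
      obtain ⟨ρ', hρ'⟩ := hc
      simp only [Fin.snoc_castSucc, Fin.snoc_last]
      refine (lex_iff_split (not_prefix_of_split hij.ne (hηi x) ⟨ρ', hρ'⟩)).2 ?_
      exact ⟨ν, i, j, ρ, ρ', hij, by simp [← hρ], by simp [← hρ']⟩
    · intro hxy
      simpa using h₂ x y (by simpa using hxy)
  · have hcast : ∀ y : Fin k, combMeet (Fin.snoc η c : Fin (k + 1) → List ℕ) y.castSucc =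
        combMeet η y := by
      refine fun y => eq_of_prefix_iff fun p => ?_
      rw [prefix_combMeet_iff, prefix_combMeet_iff]
      constructor
      · intro h z hz
        simpa using h z.castSucc (by simpa using hz)
      · intro h z
        refine Fin.lastCases ?_ (fun z => ?_) z
        · intro hz
          exact absurd hz (Fin.castSucc_lt_last y).not_ge
        · intro hz
          simpa using h z (by simpa using hz)
    constructor
    · rw [prefix_combMeet_iff]
      intro y hy
      exact prefix_combMeet_iff.1 List.prefix_rfl y
        (hy.trans (Fin.le_def.2 (Nat.le_succ x)))
    · rcases (Nat.lt_succ_iff.1 hx).eq_or_lt with hxk | hxk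
      · intro he
        have h : ν ++ [i] <+: combMeet (Fin.snoc η c : Fin (k + 1) → List ℕ) ⟨x + 1, hx⟩ := by
          rw [he]
          have := hcast ⟨x, by omega⟩
          simp only [Fin.castSucc_mk] at this
          rw [this, prefix_combMeet_iff]
          exact fun y _ => hηi y
        have h' := prefix_combMeet_iff.1 h (Fin.last k) (Fin.le_def.2 (by simp; omega))
        rw [Fin.snoc_last] at h'
        exact not_prefix_of_split hij.ne List.prefix_rfl hc h'
      · have e₁ := hcast ⟨x + 1, hxk⟩
        have e₂ := hcast ⟨x, by omega⟩
        simp only [Fin.castSucc_mk] at e₁ e₂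
        rw [e₁, e₂]
        exact (h₃ x hxk).2

/-! ### A Ramsey theorem for chains in `ω^{<ω}` -/

/-- The embedding which moves from each node to its modification by `e` before branching. -/
def climb (e : List ℕ → List ℕ) : List ℕ → List ℕ → List ℕ
  | μ, [] => e μ
  | μ, i :: τ => climb e (e μ ++ [i]) τ

theorem prefix_climb {e : List ℕ → List ℕ} (he : ∀ μ, μ <+: e μ) (μ τ : List ℕ) :
    μ <+: climb e μ τ := by
  induction τ generalizing μ with
  | nil => exact he μ
  | cons i τ ih => exact ((he μ).trans (List.prefix_append _ _)).trans (ih _)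

theorem treeEmb_climb {e : List ℕ → List ℕ} (he : ∀ μ, μ <+: e μ) (μ : List ℕ) :
    TreeEmb (climb e μ) := by
  intro η
  induction η generalizing μ with
  | nil => exact ⟨fun i => i, strictMono_id, fun i τ => prefix_climb he _ τ⟩
  | cons j η ih => exact ih _

theorem exists_climb_eq (e : List ℕ → List ℕ) (μ τ : List ℕ) : ∃ ρ, climb e μ τ = e ρ := by
  induction τ generalizing μ with
  | nil => exact ⟨μ, rfl⟩
  | cons i τ ih => exact ih _

theorem exists_treeEmb_node_monochromatic {C : Type*} [Finite C] (ε : List ℕ → C) :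
    ∃ g, TreeEmb g ∧ ∃ c, ∀ η, ε (g η) = c := by
  let S : List ℕ → Set C := fun ν => Set.range fun τ => ε (ν ++ τ)
  let ν := Function.argmin (fun ν => (S ν).ncard)
  have hdense : ∀ μ, ∃ τ, ε (ν ++ (μ ++ τ)) = ε ν := by
    intro μ
    have hsub : S (ν ++ μ) ⊆ S ν := by
      rintro _ ⟨τ, rfl⟩
      exact ⟨μ ++ τ, by simp⟩
    have heq : S (ν ++ μ) = S ν := Set.eq_of_subset_of_ncard_le hsub
      (Function.argmin_le (fun ν => (S ν).ncard) _)
    have hmem : ε ν ∈ S ν := ⟨[], by simp⟩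
    rw [← heq] at hmem
    obtain ⟨τ, hτ⟩ := hmem
    exact ⟨τ, by simpa using hτ⟩
  choose f hf using hdense
  refine ⟨(ν ++ ·) ∘ climb (fun μ => μ ++ f μ) [],
    (TreeEmb.append_left ν).comp (treeEmb_climb (fun μ => List.prefix_append _ _) _),
    ε ν, fun η => ?_⟩
  obtain ⟨ρ, hρ⟩ := exists_climb_eq (fun μ => μ ++ f μ) [] η
  simp only [Function.comp_apply, hρ]
  exact hf ρ

/-- Fusion of the embeddings `F T`, which refine the tree `T` above its root. -/
def fuse (F : (List ℕ → List ℕ) → List ℕ → List ℕ) :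
    (List ℕ → List ℕ) → List ℕ → List ℕ
  | _, [] => []
  | T, i :: τ => F T (i :: fuse F (T ∘ F T ∘ (i :: ·)) τ)

theorem treeEmb_fuse {F : (List ℕ → List ℕ) → List ℕ → List ℕ} (hF : ∀ T, TreeEmb (F T))
    (hF₀ : ∀ T, F T [] = []) (T : List ℕ → List ℕ) : TreeEmb (fuse F T) := by
  intro η
  induction η generalizing T with
  | nil =>
    obtain ⟨s, hs, h⟩ := hF T []
    refine ⟨s, hs, fun i τ => ?_⟩
    have := h i (fuse F (T ∘ F T ∘ (i :: ·)) τ)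
    rwa [hF₀] at this
  | cons j η ih =>
    obtain ⟨s, hs, h⟩ := ih (T ∘ F T ∘ (j :: ·))
    obtain ⟨t, ht, h'⟩ := hF T (j :: fuse F (T ∘ F T ∘ (j :: ·)) η)
    refine ⟨t ∘ s, ht.comp hs, fun i τ => ?_⟩
    obtain ⟨ρ, hρ⟩ := h i τ
    have := h' (s i) ρ
    simp only [List.cons_append, fuse, ← hρ]
    simpa using this

theorem IsTreeChain.exists_eq_map_cons {l : List (List ℕ)} (hl : IsTreeChain l)
    (hne : [] ∉ l) : ∃ i l', IsTreeChain l' ∧ l = l'.map (i :: ·) := by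
  obtain ⟨i, hi⟩ : ∃ i : ℕ, ∀ q ∈ l, ∃ q', q = i :: q' := by
    cases l with
    | nil => exact ⟨0, by simp⟩
    | cons p l =>
      cases p with
      | nil => simp at hne
      | cons i p =>
        refine ⟨i, fun q hq => ?_⟩
        rcases List.mem_cons.1 hq with rfl | hq
        · exact ⟨p, rfl⟩
        · obtain ⟨t, rfl⟩ := ((List.pairwise_cons.1 hl).1 q hq).1
          exact ⟨p ++ t, rfl⟩
  have e : l = (l.map List.tail).map (i :: ·) := by
    rw [List.map_map]
    conv_lhs => rw [← List.map_id l]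
    refine List.map_congr_left fun q hq => ?_
    obtain ⟨q', rfl⟩ := hi q hq
    rfl
  refine ⟨i, l.map List.tail, ?_, e⟩
  rw [e, IsTreeChain, List.pairwise_map] at hl
  exact hl.imp fun h => by simpa using h

theorem exists_treeEmb_root_monochromatic {C : Type*} [Finite C] {N : ℕ}
    (hN : ∀ χ : List (List ℕ) → C, ∃ g, TreeEmb g ∧ ∃ c, ∀ l : List (List ℕ), l.length = N →
      IsTreeChain l → χ (l.map g) = c) (χ : List (List ℕ) → C) :
    ∃ g, TreeEmb g ∧ g [] = [] ∧ ∃ c, ∀ l : List (List ℕ), l.length = N →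
      IsTreeChain l → [] ∉ l → χ (l.map g) = c := by
  choose g hg c hc using fun i : ℕ => hN fun l => χ (l.map (i :: ·))
  obtain ⟨c₀, hinf⟩ := Finite.exists_infinite_fiber c
  have : Infinite (c ⁻¹' {c₀}) := hinf
  classical
  let s := Nat.orderEmbeddingOfSet (c ⁻¹' {c₀})
  have hs : ∀ i, c (s i) = c₀ := fun i => by
    have : s i ∈ Set.range s := ⟨i, rfl⟩
    rw [Nat.orderEmbeddingOfSet_range] at this
    exact this
  let h : List ℕ → List ℕ
    | [] => []
    | i :: τ => s i :: g (s i) τ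
  refine ⟨h, ?_, rfl, c₀, fun l hlN hl hne => ?_⟩
  · rintro (_ | ⟨j, η⟩)
    · exact ⟨s, s.strictMono, fun i τ => by simp [h]⟩
    · obtain ⟨t, ht, ht'⟩ := hg (s j) η
      exact ⟨t, ht, fun i τ => by simpa [h] using ht' i τ⟩
  · obtain ⟨i, l', hl', rfl⟩ := hl.exists_eq_map_cons hne
    have := hc (s i) l' (by simpa using hlN) hl'
    rw [hs] at this
    rw [← this, List.map_map, List.map_map]
    rfl

theorem exists_treeEmb_chain_monochromatic {C : Type*} [Finite C] (N : ℕ)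
    (χ : List (List ℕ) → C) :
    ∃ g, TreeEmb g ∧ ∃ c, ∀ l : List (List ℕ), l.length = N → IsTreeChain l →
      χ (l.map g) = c := by
  induction N generalizing χ with
  | zero =>
    refine ⟨_, TreeEmb.id, χ [], fun l hl _ => ?_⟩
    rw [List.length_eq_zero_iff.1 hl, List.map_nil]
  | succ N ih =>
    choose F hF hF₀ c hc using fun T : List ℕ → List ℕ =>
      exists_treeEmb_root_monochromatic ih fun l => χ (T [] :: l.map T)
    have hJ := treeEmb_fuse hF hF₀
    have key : ∀ r T, ∃ d, ∀ l : List (List ℕ), l.length = N → IsTreeChain (r :: l) →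
        χ ((r :: l).map (T ∘ fuse F T)) = d := by
      intro r
      induction r with
      | nil =>
        intro T
        let K : List ℕ → List ℕ
          | [] => []
          | i :: τ => i :: fuse F (T ∘ F T ∘ (i :: ·)) τ
        have hK : TreeEmb K := by
          rintro (_ | ⟨j, η⟩)
          · exact ⟨fun i => i, strictMono_id, fun i τ => by simp [K]⟩
          · obtain ⟨t, ht, ht'⟩ := hJ (T ∘ F T ∘ (j :: ·)) η
            exact ⟨t, ht, fun i τ => by simpa [K] using ht' i τ⟩
        have hJK : fuse F T = F T ∘ K := by
          funext τ
          cases τ with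
          | nil => simp [fuse, K, hF₀]
          | cons i τ => simp [fuse, K]
        refine ⟨c T, fun l hlN hl => ?_⟩
        obtain ⟨hl₁, hl₂⟩ := List.pairwise_cons.1 hl
        rw [← hc T (l.map K) (by simpa using hlN) (hK.isTreeChain_map hl₂)]
        · simp [hJK, K, hF₀]
        · intro hmem
          obtain ⟨q, hq, hq'⟩ := List.mem_map.1 hmem
          cases q with
          | nil => exact (hl₁ _ hq).2 rfl
          | cons i τ => simp [K] at hq'
      | cons j r ihr =>
        intro T
        obtain ⟨d, hd⟩ := ihr (T ∘ F T ∘ (j :: ·))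
        refine ⟨d, fun l hlN hl => ?_⟩
        have hne : [] ∉ r.cons j :: l := by
          intro h
          rcases List.mem_cons.1 h with h | h
          · simp at h
          · simpa using ((List.pairwise_cons.1 hl).1 _ h).1
        obtain ⟨i, l', hl', e⟩ := hl.exists_eq_map_cons hne
        cases l' with
        | nil => simp at e
        | cons r' l' =>
          simp only [List.map_cons, List.cons.injEq] at e
          obtain ⟨⟨rfl, rfl⟩, rfl⟩ := e
          rw [← hd l' (by simpa using hlN) hl']
          simp [fuse, Function.comp_def]
    choose ε hε using fun r => key r id
    obtain ⟨g, hg, d, hd⟩ := exists_treeEmb_node_monochromatic ε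
    refine ⟨fuse F id ∘ g, (hJ id).comp hg, d, fun l hlN hl => ?_⟩
    cases l with
    | nil => simp at hlN
    | cons r l =>
      have := hε (g r) (l.map g) (by simpa using hlN) (hg.isTreeChain_map hl)
      rw [← hd r, ← this]
      simp

/-! ### Compactness for trees of parameters -/

section

variable {L : FirstOrder.Language.{u, u}} {𝕄 : Type u} [L.Structure 𝕄]

theorem IsSaturated.exists_realize {κ : Cardinal.{u}} (hs : IsSaturated L 𝕄 κ)
    (hκ : Cardinal.aleph0 < κ) {V ι : Type} [Countable V] [Countable ι] {n : ℕ}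
    (ψ : ι → L.Formula (V ⊕ Fin n)) (c : ι → Fin n → 𝕄)
    (h : ∀ s : Finset ι, ∃ v : V → 𝕄, ∀ i ∈ s, (ψ i).Realize (Sum.elim v (c i))) :
    ∃ v : V → 𝕄, ∀ i, (ψ i).Realize (Sum.elim v (c i)) := by
  classical
  let f : ι → FmlP L 𝕄 (ULift.{u} V) := fun i =>
    ⟨n, (ψ i).relabel (Sum.map ULift.up id), c i⟩
  have hf : ∀ i (v : ULift.{u} V → 𝕄), (f i).2.1.Realize (Sum.elim v (f i).2.2) ↔
      (ψ i).Realize (Sum.elim (v ∘ ULift.up) (c i)) := by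
    intro i v
    simp only [f, Formula.realize_relabel, Sum.elim_comp_map, Function.comp_id]
  obtain ⟨v, hv⟩ := hs (ULift.{u} V) (⋃ i, Set.range (c i))
    ((Cardinal.mk_le_aleph0_iff.2 inferInstance).trans_lt hκ)
    ((Cardinal.le_aleph0_iff_set_countable.2
      (Set.countable_iUnion fun i => Set.countable_range _)).trans_lt hκ)
    (Set.range f) (by
      rintro _ ⟨i, rfl⟩ j
      exact Set.mem_iUnion.2 ⟨i, j, rfl⟩)
    (by
      intro t ht
      obtain ⟨s, -, rfl⟩ := Finset.subset_set_image_iff.1 (by simpa using ht :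
        (t : Set _) ⊆ f '' Set.univ)
      obtain ⟨v, hv⟩ := h s
      refine ⟨v ∘ ULift.down, fun p hp => ?_⟩
      obtain ⟨i, hi, rfl⟩ := Finset.mem_image.1 hp
      exact (hf i _).2 (hv i hi))
  exact ⟨v ∘ ULift.up, fun i => (hf i v).1 (hv _ ⟨i, rfl⟩)⟩

theorem exists_formula_realize_iff_exists_forall_mem {r m : ℕ} (φ : L.Formula (Fin r ⊕ Fin m))
    {I : Type} (l : List I) :
    ∃ θ : L.Formula ((I × Fin m) ⊕ Fin 0), ∀ (v : I × Fin m → 𝕄) (c : Fin 0 → 𝕄),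
      θ.Realize (Sum.elim v c) ↔
        ∃ a : Fin r → 𝕄, ∀ p ∈ l, φ.Realize (Sum.elim a fun q => v (p, q)) := by
  refine ⟨(Formula.iInf fun i : Fin l.length => φ.relabel
    (Sum.elim Sum.inr fun q => Sum.inl (Sum.inl (l.get i, q)))).iExs (Fin r), fun v c => ?_⟩
  simp only [Formula.realize_iExs, Formula.realize_iInf, Formula.realize_relabel]
  refine exists_congr fun a => ?_
  rw [List.forall_mem_iff_get]
  refine forall_congr' fun i => iff_of_eq (congrArg _ ?_)
  funext x
  cases x <;> rfl

theorem exists_formula_realize_iff_forall {r m : ℕ} (φ : L.Formula (Fin r ⊕ Fin m)) (n : ℕ) :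
    ∃ θ : L.Formula (Fin r ⊕ Fin (n * m)), ∀ (a : Fin r → 𝕄) (y : Fin n → Fin m → 𝕄),
      θ.Realize (Sum.elim a fun q => y (finProdFinEquiv.symm q).1 (finProdFinEquiv.symm q).2) ↔
        ∀ i, φ.Realize (Sum.elim a (y i)) := by
  refine ⟨Formula.iInf fun i : Fin n => φ.relabel
    (Sum.map id fun q => finProdFinEquiv (i, q)), fun a y => ?_⟩
  simp only [Formula.realize_iInf, Formula.realize_relabel]
  refine forall_congr' fun i => iff_of_eq (congrArg _ ?_)
  funext x
  cases x <;> simp [-finProdFinEquiv_symm_apply]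

/-- The nodes of the branch `σ` are the initial segments of its restrictions. -/
theorem ofFn_prefix_ofFn {A : Type*} (σ : ℕ → A) {n n' : ℕ} (h : n ≤ n') :
    (List.ofFn fun i : Fin n => σ i) <+: List.ofFn fun i : Fin n' => σ i := by
  rw [List.prefix_iff_eq_take]
  refine List.ext_getElem (by simp [h]) fun i h₁ h₂ => by simp

theorem exists_branch {A : Type*} [Inhabited A] (q : List A) :
    ∃ σ : ℕ → A, ∀ p, p <+: q → p = List.ofFn fun i : Fin p.length => σ i := by
  refine ⟨fun i => q.getD i default, fun p hp => ?_⟩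
  refine List.ext_getElem (by simp) fun i h₁ h₂ => ?_
  obtain ⟨t, rfl⟩ := hp
  simp [List.getElem?_append_left h₁, List.getElem?_eq_getElem h₁]

theorem exists_forall_prefix_of_branches {A : Type} [Inhabited A] {r m : ℕ}
    {φ : L.Formula (Fin r ⊕ Fin m)} {b : List A → Fin m → 𝕄}
    (h : ∀ σ : ℕ → A, ∃ a : Fin r → 𝕄,
      ∀ n : ℕ, φ.Realize (Sum.elim a (b (List.ofFn fun i : Fin n => σ i)))) (q : List A) :
    ∃ a : Fin r → 𝕄, ∀ p, p <+: q → φ.Realize (Sum.elim a (b p)) := by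
  obtain ⟨σ, hσ⟩ := exists_branch q
  obtain ⟨a, ha⟩ := h σ
  refine ⟨a, fun p hp => ?_⟩
  rw [hσ p hp]
  exact ha _

theorem IsSaturated.branches_of_forall_prefix {κ : Cardinal.{u}} (hs : IsSaturated L 𝕄 κ)
    (hκ : Cardinal.aleph0 < κ) {A : Type} {r m : ℕ}
    {φ : L.Formula (Fin r ⊕ Fin m)} {b : List A → Fin m → 𝕄}
    (h : ∀ q : List A, ∃ a : Fin r → 𝕄, ∀ p, p <+: q → φ.Realize (Sum.elim a (b p)))
    (σ : ℕ → A) : ∃ a : Fin r → 𝕄,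
      ∀ n : ℕ, φ.Realize (Sum.elim a (b (List.ofFn fun i : Fin n => σ i))) := by
  refine hs.exists_realize hκ (fun _ : ℕ => φ) (fun n => b (List.ofFn fun i : Fin n => σ i))
    fun s => ?_
  obtain ⟨a, ha⟩ := h (List.ofFn fun i : Fin (s.sup id) => σ i)
  exact ⟨a, fun n hn => ha _ (ofFn_prefix_ofFn σ (Finset.le_sup (f := id) hn))⟩

theorem IsSaturated.exists_tree {κ : Cardinal.{u}} (hs : IsSaturated L 𝕄 κ)
    (hκ : Cardinal.aleph0 < κ) {A : Type} [Countable A] {r m : ℕ}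
    (φ : L.Formula (Fin r ⊕ Fin m)) (Neg : Set (List (List A)))
    (h : ∀ n : ℕ, ∃ b : List A → Fin m → 𝕄,
      (∀ q : List A, q.length ≤ n →
        ∃ a : Fin r → 𝕄, ∀ p, p <+: q → φ.Realize (Sum.elim a (b p))) ∧
      ∀ l ∈ Neg, (∀ p ∈ l, p.length ≤ n) →
        ¬ ∃ a : Fin r → 𝕄, ∀ p ∈ l, φ.Realize (Sum.elim a (b p))) :
    ∃ b : List A → Fin m → 𝕄,
      (∀ σ : ℕ → A, ∃ a : Fin r → 𝕄,
        ∀ n : ℕ, φ.Realize (Sum.elim a (b (List.ofFn fun i : Fin n => σ i)))) ∧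
      ∀ l ∈ Neg, ¬ ∃ a : Fin r → 𝕄, ∀ p ∈ l, φ.Realize (Sum.elim a (b p)) := by
  choose θ hθ using fun l : List (List A) =>
    exists_formula_realize_iff_exists_forall_mem (𝕄 := 𝕄) φ l
  let ψ : List A ⊕ Neg → L.Formula ((List A × Fin m) ⊕ Fin 0) :=
    Sum.elim (fun q => θ q.inits) fun l => (θ l).not
  let bound : List A ⊕ Neg → ℕ :=
    Sum.elim List.length fun l => (l.1.map List.length).sum
  obtain ⟨v, hv⟩ := hs.exists_realize hκ ψ (fun _ => Fin.elim0) (by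
    intro s
    obtain ⟨b, hb₁, hb₂⟩ := h (s.sup bound)
    refine ⟨fun x => b x.1 x.2, ?_⟩
    rintro (q | l) hi
    · refine (hθ _ _ _).2 ?_
      obtain ⟨a, ha⟩ := hb₁ q (Finset.le_sup (f := bound) hi)
      exact ⟨a, fun p hp => ha p ((List.mem_inits _ _).1 hp)⟩
    · refine (not_congr (hθ _ _ _)).2 (hb₂ l l.2 fun p hp => ?_)
      exact (List.single_le_sum (by simp) _ (List.mem_map_of_mem hp)).trans
        (Finset.le_sup (f := bound) hi))
  refine ⟨fun p q => v (p, q), hs.branches_of_forall_prefix (b := fun p q => v (p, q)) hκ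
    fun q => ?_, fun l hl => ?_⟩
  · obtain ⟨a, ha⟩ := (hθ _ _ _).1 (hv (.inl q))
    exact ⟨a, fun p hp => ha p ((List.mem_inits _ _).2 hp)⟩
  · exact (not_congr (hθ _ _ _)).1 (hv (.inr ⟨l, hl⟩))

/-! ### Trees of chains -/

/-- The range of `g` lies in a cone from which `c` branches off to the right. -/
def LeftOf (g : List ℕ → List ℕ) (c : List ℕ) : Prop :=
  ∃ ν i j, i < j ∧ ν ++ [j] <+: c ∧ ∀ η, ν ++ [i] <+: g η

/-- The chain consisting of the first `n` nodes of the leftmost branch. -/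
def leftmostChain (n : ℕ) : List (List ℕ) :=
  (List.range n).map fun i => List.replicate i 0

theorem isTreeChain_leftmostChain (n : ℕ) : IsTreeChain (leftmostChain n) := by
  rw [IsTreeChain, leftmostChain, List.pairwise_map]
  refine List.pairwise_lt_range.imp fun {i j} hij => ⟨?_, fun h => ?_⟩
  · exact ⟨List.replicate (j - i) 0, by rw [← List.replicate_add]; congr 1; omega⟩
  · have := congrArg List.length h
    simp at this
    omega

theorem prefix_of_mem_leftmostChain {n : ℕ} {p : List ℕ} (hp : p ∈ leftmostChain n) :
    p <+: List.replicate n 0 := by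
  obtain ⟨i, hi, rfl⟩ := List.mem_map.1 hp
  have hi := List.mem_range.1 hi
  exact ⟨List.replicate (n - i) 0, by rw [← List.replicate_add]; congr 1; omega⟩

theorem exists_tree_of_chains {Incon : List (List ℕ) → Prop}
    (hIncon : ∀ l l', l ⊆ l' → Incon l → Incon l') {N : ℕ}
    (hN : ∀ c g, TreeEmb g → LeftOf g c →
      ∃ l : List (List ℕ), l.length = N + 1 ∧ IsTreeChain l ∧ Incon (c :: l.map g))
    (n : ℕ) (g : List ℕ → List ℕ) (hg : TreeEmb g) :
    ∃ T : List Bool → List (List ℕ),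
      (∀ η, ∃ l, IsTreeChain l ∧ l.length = N + 1 ∧ T η = l.map g) ∧
      (∀ η, η.length ≤ n → ∃ q, ∀ ν, ν <+: η → ∀ p ∈ T ν, p <+: g q) ∧
      ∀ η η', η.length ≤ n → η'.length ≤ n → ¬ η <+: η' → ¬ η' <+: η →
        Incon (T η ++ T η') := by
  induction n generalizing g with
  | zero =>
    refine ⟨fun _ => (leftmostChain (N + 1)).map g, fun _ =>
      ⟨_, isTreeChain_leftmostChain _, by simp [leftmostChain], rfl⟩,
      fun η _ => ⟨List.replicate (N + 1) 0, fun ν _ p hp => ?_⟩, fun η η' h _ hη _ => ?_⟩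
    · obtain ⟨p', hp', rfl⟩ := List.mem_map.1 hp
      exact hg.mono (prefix_of_mem_leftmostChain hp')
    · rw [List.length_eq_zero_iff.1 (Nat.le_zero.1 h)] at hη
      exact absurd List.nil_prefix hη
  | succ n ih =>
    let μ := List.replicate (N + 1) 0
    have hμ := TreeEmb.append_left μ
    have hcone : ∀ i, TreeEmb ((μ ++ ·) ∘ (i :: ·)) := fun i => hμ.comp (.cons i)
    obtain ⟨R, hR₁, hR₂, hR₃⟩ := ih (g ∘ (μ ++ ·) ∘ (1 :: ·)) (hg.comp (hcone 1))
    have : Finite {r : List Bool // r.length ≤ n} := (List.finite_length_le Bool n).to_subtype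
    obtain ⟨h, hh, d, hd⟩ := exists_treeEmb_chain_monochromatic (N + 1)
      fun l (r : {r : List Bool // r.length ≤ n}) =>
        Incon (l.map (g ∘ (μ ++ ·) ∘ (0 :: ·)) ++ R r.1)
    have hleft : TreeEmb (g ∘ ((μ ++ ·) ∘ (0 :: ·)) ∘ h) := hg.comp ((hcone 0).comp hh)
    have hbad : ∀ l, l.length = N + 1 → IsTreeChain l → ∀ r, r.length ≤ n →
        Incon (l.map (g ∘ ((μ ++ ·) ∘ (0 :: ·)) ∘ h) ++ R r) := by
      intro l hlN hl r hr
      obtain ⟨lr, -, hlr, hRr⟩ := hR₁ r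
      obtain ⟨c, hc⟩ : ∃ c, c ∈ lr := List.exists_mem_of_length_pos (by omega)
      have hleftOf : LeftOf (g ∘ ((μ ++ ·) ∘ (0 :: ·)) ∘ h)
          ((g ∘ (μ ++ ·) ∘ (1 :: ·)) c) := by
        obtain ⟨s, hs, hs'⟩ := hg μ
        exact ⟨g μ, s 0, s 1, hs Nat.zero_lt_one, hs' 1 c, fun η => hs' 0 (h η)⟩
      obtain ⟨l', hl'N, hl', hl'c⟩ := hN _ _ hleft hleftOf
      have e₁ := congrFun (hd l hlN hl) ⟨r, hr⟩
      have e₂ := congrFun (hd l' hl'N hl') ⟨r, hr⟩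
      have e := e₁.trans e₂.symm
      simp only [List.map_map] at e
      refine e.mpr (hIncon _ _ ?_ hl'c)
      refine List.cons_subset.2 ⟨List.mem_append_right _ ?_, List.subset_append_left _ _⟩
      rw [hRr]
      exact List.mem_map_of_mem hc
    obtain ⟨T, hT₁, hT₂, hT₃⟩ := ih _ hleft
    let U : List Bool → List (List ℕ)
      | [] => (leftmostChain (N + 1)).map g
      | false :: η => T η
      | true :: η => R η
    have hroot : ∀ p ∈ U [], ∀ τ, p <+: g (μ ++ τ) := by
      intro p hp τ
      obtain ⟨p', hp', rfl⟩ := List.mem_map.1 hp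
      exact hg.mono ((prefix_of_mem_leftmostChain hp').trans (List.prefix_append _ _))
    refine ⟨U, ?_, ?_, ?_⟩
    · rintro (_ | ⟨_ | _, η⟩)
      · exact ⟨_, isTreeChain_leftmostChain _, by simp [leftmostChain], rfl⟩
      · obtain ⟨l, hl, hlN, e⟩ := hT₁ η
        exact ⟨_, ((hcone 0).comp hh).isTreeChain_map hl, by simpa using hlN,
          by rw [List.map_map]; exact e⟩
      · obtain ⟨l, hl, hlN, e⟩ := hR₁ η
        exact ⟨_, (hcone 1).isTreeChain_map hl, by simpa using hlN,
          by rw [List.map_map]; exact e⟩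
    · rintro (_ | ⟨_ | _, η⟩) hη
      · refine ⟨μ, fun ν hν p hp => ?_⟩
        rw [List.prefix_nil.1 hν] at hp
        simpa using hroot p hp []
      · obtain ⟨q, hq⟩ := hT₂ η (by simpa using hη)
        refine ⟨μ ++ 0 :: h q, fun ν hν p hp => ?_⟩
        cases ν with
        | nil => exact hroot p hp _
        | cons x ν =>
          obtain ⟨rfl, hν'⟩ := List.cons_prefix_cons.1 hν
          exact hq ν hν' p hp
      · obtain ⟨q, hq⟩ := hR₂ η (by simpa using hη)
        refine ⟨μ ++ 1 :: q, fun ν hν p hp => ?_⟩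
        cases ν with
        | nil => exact hroot p hp _
        | cons x ν =>
          obtain ⟨rfl, hν'⟩ := List.cons_prefix_cons.1 hν
          exact hq ν hν' p hp
    · have hcross : ∀ η η' : List Bool, η.length ≤ n → η'.length ≤ n → Incon (T η ++ R η') := by
        intro η η' _ hη'
        obtain ⟨l, hl, hlN, e⟩ := hT₁ η
        rw [e]
        exact hbad l hlN hl η' hη'
      intro η η' hη hη' h₁ h₂
      rcases η with _ | ⟨_ | _, η⟩
      · exact absurd List.nil_prefix h₁
      all_goals
        rcases η' with _ | ⟨_ | _, η'⟩
        · exact absurd List.nil_prefix h₂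
      · exact hT₃ η η' (by simpa using hη) (by simpa using hη') (by simpa using h₁)
          (by simpa using h₂)
      · exact hcross η η' (by simpa using hη) (by simpa using hη')
      · exact hIncon _ _ (by simp [U])
          (hcross η' η (by simpa using hη') (by simpa using hη))
      · exact hR₃ η η' (by simpa using hη) (by simpa using hη') (by simpa using h₁)
          (by simpa using h₂)

/-! ### `SOP₂` and `k`-`DCTP₁` -/

/-- The embedding of `ω^{<ω}` into `2^{<ω}` sending `⟨n₁, …, n_l⟩` to `1^{n₁} 0 … 1^{n_l} 0`. -/
def unaryCode (η : List ℕ) : List Bool :=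
  η.flatMap fun n => List.replicate n true ++ [false]

theorem exists_split_unaryCode (ν : List ℕ) {i j : ℕ} (hij : i < j) (τ τ' : List ℕ) :
    ∃ μ, μ ++ [false] <+: unaryCode (ν ++ i :: τ) ∧ μ ++ [true] <+: unaryCode (ν ++ j :: τ') := by
  refine ⟨unaryCode ν ++ List.replicate i true, ⟨unaryCode τ, by simp [unaryCode]⟩,
    ⟨List.replicate (j - i - 1) true ++ false :: unaryCode τ', ?_⟩⟩
  have : j = i + 1 + (j - i - 1) := by omega
  conv_rhs => rw [this]
  simp [unaryCode, List.replicate_add]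

theorem unaryCode_not_prefix {a b : List ℕ} (h₁ : ¬ a <+: b) (h₂ : ¬ b <+: a) :
    ¬ unaryCode a <+: unaryCode b := by
  obtain ⟨ν, i, j, τ, τ', hij, rfl, rfl⟩ := exists_split_of_incomparable a b h₁ h₂
  rcases hij.lt_or_gt with hij | hij
  · obtain ⟨μ, h, h'⟩ := exists_split_unaryCode ν hij τ τ'
    exact not_prefix_of_split (by simp) h h'
  · obtain ⟨μ, h, h'⟩ := exists_split_unaryCode ν hij τ' τ
    exact not_prefix_of_split (by simp) h' h

theorem HasSOP2.hasKDCTP1 {κ : Cardinal.{u}} (hs : IsSaturated L 𝕄 κ)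
    (hκ : Cardinal.aleph0 < κ) {k : ℕ} (hk : 2 ≤ k) (h : HasSOP2 L 𝕄) : HasKDCTP1 L 𝕄 k := by
  obtain ⟨r, m, φ, b, hb₁, hb₂⟩ := h
  refine ⟨r, m, φ, b ∘ unaryCode, fun σ => hs.branches_of_forall_prefix hκ (fun q => ?_) σ, ?_⟩
  · obtain ⟨a, ha⟩ := exists_forall_prefix_of_branches hb₁ (unaryCode q)
    exact ⟨a, fun p hp => ha _ (hp.flatMap _)⟩
  · rintro η hη ⟨a, ha⟩
    let x : Fin k := ⟨0, by omega⟩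
    let y : Fin k := ⟨1, by omega⟩
    have hxy : x ≠ y := by simp [x, y]
    have h₁ := hη.1 x y hxy
    have h₂ := hη.1 y x hxy.symm
    exact hb₂ _ _ (unaryCode_not_prefix h₁ h₂) (unaryCode_not_prefix h₂ h₁) ⟨a, ha x, ha y⟩

theorem not_hasKDCTP1_one : ¬ HasKDCTP1 L 𝕄 1 := by
  rintro ⟨r, m, φ, b, hb₁, hb₂⟩
  refine hb₂ (fun _ => []) ⟨?_, ?_, ?_⟩ ?_
  · exact fun i j hij => absurd (Subsingleton.elim i j) hij
  · exact fun i j hij => absurd (Subsingleton.elim i j) hij.ne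
  · exact fun i hi => absurd hi (by omega)
  · obtain ⟨a, ha⟩ := hb₁ fun _ => 0
    exact ⟨a, fun _ => ha 0⟩

/-- A tree in which no long chain to the left of a node is always consistent with that node
yields `SOP₂`. -/
theorem hasSOP2_of_chains {κ : Cardinal.{u}} (hs : IsSaturated L 𝕄 κ)
    (hκ : Cardinal.aleph0 < κ) {r m : ℕ} {φ : L.Formula (Fin r ⊕ Fin m)}
    {b : List ℕ → Fin m → 𝕄}
    (hb : ∀ q, ∃ a : Fin r → 𝕄, ∀ p, p <+: q → φ.Realize (Sum.elim a (b p))) {N : ℕ}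
    (hN : ∀ c g, TreeEmb g → LeftOf g c →
      ∃ l : List (List ℕ), l.length = N + 1 ∧ IsTreeChain l ∧
        ¬ ∃ a : Fin r → 𝕄, ∀ p ∈ c :: l.map g, φ.Realize (Sum.elim a (b p))) :
    HasSOP2 L 𝕄 := by
  obtain ⟨θ, hθ⟩ := exists_formula_realize_iff_forall (𝕄 := 𝕄) φ (N + 1)
  obtain ⟨b', hb'₁, hb'₂⟩ := hs.exists_tree hκ θ
    {l : List (List Bool) | ∃ η η', ¬ η <+: η' ∧ ¬ η' <+: η ∧ l = [η, η']} (by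
      intro n
      obtain ⟨T, hT₁, hT₂, hT₃⟩ := exists_tree_of_chains
        (Incon := fun l => ¬ ∃ a : Fin r → 𝕄, ∀ p ∈ l, φ.Realize (Sum.elim a (b p)))
        (fun l l' hl hcon ⟨a, ha⟩ => hcon ⟨a, fun p hp => ha p (hl hp)⟩) hN n _ TreeEmb.id
      have hlen : ∀ η, (T η).length = N + 1 := fun η => by
        obtain ⟨l, -, hl, e⟩ := hT₁ η
        rw [e, List.length_map, hl]
      let B : List Bool → Fin (N + 1) → Fin m → 𝕄 := fun η i =>
        b ((T η).get (i.cast (hlen η).symm))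
      have hB : ∀ a η, θ.Realize (Sum.elim a fun q =>
          B η (finProdFinEquiv.symm q).1 (finProdFinEquiv.symm q).2) ↔
          ∀ p ∈ T η, φ.Realize (Sum.elim a (b p)) := by
        intro a η
        rw [hθ, List.forall_mem_iff_get]
        exact (finCongr (hlen η).symm).forall_congr fun _ => Iff.rfl
      refine ⟨fun η q => B η (finProdFinEquiv.symm q).1 (finProdFinEquiv.symm q).2, ?_, ?_⟩
      · intro η hη
        obtain ⟨q, hq⟩ := hT₂ η hη
        obtain ⟨a, ha⟩ := hb q
        exact ⟨a, fun ν hν => (hB a ν).2 fun p hp => ha p (hq ν hν p hp)⟩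
      · rintro _ ⟨η, η', h₁, h₂, rfl⟩ hlen ⟨a, ha⟩
        refine hT₃ η η' (hlen η (by simp)) (hlen η' (by simp)) h₁ h₂ ⟨a, fun p hp => ?_⟩
        rcases List.mem_append.1 hp with hp | hp
        · exact (hB a η).1 (ha η (by simp)) p hp
        · exact (hB a η').1 (ha η' (by simp)) p hp)
  refine ⟨r, (N + 1) * m, θ, b', hb'₁, fun η η' h₁ h₂ ⟨a, ha, ha'⟩ => ?_⟩
  refine hb'₂ _ ⟨η, η', h₁, h₂, rfl⟩ ⟨a, fun p hp => ?_⟩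
  rcases List.mem_pair.1 hp with rfl | rfl
  · exact ha
  · exact ha'

/-- If arbitrarily long chains to the left of a node are always consistent with that node, then
adding that node to the formula decreases the size of the inconsistent combs. -/
theorem hasKDCTP1_of_chains {κ : Cardinal.{u}} (hs : IsSaturated L 𝕄 κ)
    (hκ : Cardinal.aleph0 < κ) {k r m : ℕ} (hk : 1 ≤ k) {φ : L.Formula (Fin r ⊕ Fin m)}
    {b : List ℕ → Fin m → 𝕄}
    (hb : ∀ η : Fin (k + 1) → List ℕ, DescendingComb η →
      ¬ ∃ a : Fin r → 𝕄, ∀ i, φ.Realize (Sum.elim a (b (η i))))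
    (hN : ∀ N : ℕ, ∃ c g, TreeEmb g ∧ LeftOf g c ∧
      ∀ l : List (List ℕ), l.length = N + 1 → IsTreeChain l →
        ∃ a : Fin r → 𝕄, ∀ p ∈ c :: l.map g, φ.Realize (Sum.elim a (b p))) :
    HasKDCTP1 L 𝕄 k := by
  obtain ⟨θ, hθ⟩ := exists_formula_realize_iff_forall (𝕄 := 𝕄) φ 2
  obtain ⟨b', hb'₁, hb'₂⟩ := hs.exists_tree hκ θ
    {l : List (List ℕ) | ∃ η : Fin k → List ℕ, DescendingComb η ∧ l = List.ofFn η} (by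
      intro N
      obtain ⟨c, g, hg, ⟨ν, i, j, hij, hc, hν⟩, hcon⟩ := hN N
      let B : List ℕ → Fin 2 → Fin m → 𝕄 := fun η => ![b (g η), b c]
      have hB : ∀ a η, θ.Realize (Sum.elim a fun q =>
          B η (finProdFinEquiv.symm q).1 (finProdFinEquiv.symm q).2) ↔
          φ.Realize (Sum.elim a (b (g η))) ∧ φ.Realize (Sum.elim a (b c)) := by
        intro a η
        rw [hθ, Fin.forall_fin_two]
        rfl
      refine ⟨fun η q => B η (finProdFinEquiv.symm q).1 (finProdFinEquiv.symm q).2, ?_, ?_⟩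
      · intro q hq
        let q' := q ++ List.replicate (N - q.length) 0
        have hq' : q'.length = N := by simp [q']; omega
        obtain ⟨a, ha⟩ := hcon ((List.range (N + 1)).map q'.take) (by simp) (by
          rw [IsTreeChain, List.pairwise_map]
          refine (List.pairwise_lt_range (n := N + 1)).imp_of_mem
            fun {x y} hx hy hxy => ⟨List.take_prefix_take_left hxy.le, fun h => ?_⟩
          have hx := List.mem_range.1 hx
          have hy := List.mem_range.1 hy
          have := congrArg List.length h
          simp only [List.length_take, hq'] at this
          omega)
        refine ⟨a, fun p hp => (hB a p).2
          ⟨ha _ (List.mem_cons_of_mem _ (List.mem_map_of_mem ?_)), ha c (by simp)⟩⟩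
        have hpq : p <+: q' := hp.trans (List.prefix_append _ _)
        refine List.mem_map.2 ⟨p.length, List.mem_range.2 ?_, (List.prefix_iff_eq_take.1 hpq).symm⟩
        have := hpq.length_le
        omega
      · rintro _ ⟨η, hη, rfl⟩ - ⟨a, ha⟩
        have ha : ∀ x, _ := fun x => (hB a (η x)).1 (ha (η x) (List.mem_ofFn.2 ⟨x, rfl⟩))
        refine hb _ ((hg.descendingComb hη).snoc hij (fun x => hν _) hc) ⟨a, fun x => ?_⟩
        refine Fin.lastCases ?_ (fun x => ?_) x
        · simpa using (ha ⟨0, hk⟩).2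
        · simpa using (ha x).1)
  refine ⟨r, 2 * m, θ, b', hb'₁, fun η hη ⟨a, ha⟩ => hb'₂ _ ⟨η, hη, rfl⟩ ⟨a, fun p hp => ?_⟩⟩
  obtain ⟨i, rfl⟩ := List.mem_ofFn.1 hp
  exact ha i

theorem HasKDCTP1.hasSOP2 {κ : Cardinal.{u}} (hs : IsSaturated L 𝕄 κ)
    (hκ : Cardinal.aleph0 < κ) {k : ℕ} (hk : 1 ≤ k) (h : HasKDCTP1 L 𝕄 k) : HasSOP2 L 𝕄 := by
  induction k, hk using Nat.le_induction with
  | base => exact absurd h not_hasKDCTP1_one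
  | succ k hk ih =>
    obtain ⟨r, m, φ, b, hb₁, hb₂⟩ := h
    by_cases hN : ∃ N : ℕ, ∀ c g, TreeEmb g → LeftOf g c →
      ∃ l : List (List ℕ), l.length = N + 1 ∧ IsTreeChain l ∧
        ¬ ∃ a : Fin r → 𝕄, ∀ p ∈ c :: l.map g, φ.Realize (Sum.elim a (b p))
    · obtain ⟨N, hN⟩ := hN
      exact hasSOP2_of_chains hs hκ (exists_forall_prefix_of_branches hb₁) hN
    · refine ih (hasKDCTP1_of_chains hs hκ hk hb₂ fun N => ?_)
      by_contra hcon
      refine hN ⟨N, fun c g hg hgc => ?_⟩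
      by_contra hl
      exact hcon ⟨c, g, hg, hgc, fun l hlN hlc => by_contra fun ha => hl ⟨l, hlN, hlc, ha⟩⟩

end

/-- **Lemma 2.8.** For any `k ≥ 2`, a complete first-order theory `T` has
`SOP₂` if and only if it has `k`-`DCTP₁`.  Stated in a monster model `𝕄` of
`T = Th(𝕄)`. -/
theorem sop2_iff_kdctp1 (L : FirstOrder.Language.{u, u}) (𝕄 : Type u) [L.Structure 𝕄]
    (κ : Cardinal.{u}) (hmonster : IsMonster L 𝕄 κ)
    (k : ℕ) (hk : 2 ≤ k) : HasSOP2 L 𝕄 ↔ HasKDCTP1 L 𝕄 k := by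
  exact ⟨HasSOP2.hasKDCTP1 hmonster.2.1 hmonster.1 hk,
    HasKDCTP1.hasSOP2 hmonster.2.1 hmonster.1 (by omega)⟩

end NSOP2Paper
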